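/- arXiv:1705.04810 — 8 statements merged into one kernel-verified Lean document; each statement's English description precedes it below -/
import Mathlib

section
/- Let ω_p : ℝ → ℝ be positive and twice differentiable, let Z̃ : ℝ → M₂(ℝ) satisfy Z̃(s)ᵀ = Z̃(s) for all s, and let D₁, D₂ : ℝ → M₂(ℝ) be such that for each i the function ω_p·Dᵢ is twice differentiable and satisfies the reparametrised matrix Jacobi equation ω_p(s)⁻² · d/ds ( ω_p(s)⁻² · d/ds ( ω_p(s)·Dᵢ(s) ) ) = ω_p(s)·Dᵢ(s)·Z̃(s) for all s. Then the function s ↦ (d/ds D₁(s))·D₂(s)ᵀ − D₁(s)·(d/ds D₂(s)ᵀ) has vanishing derivative, i.e. it is constant on ℝ (conservation law for Jacobi matrices of light bundles in a plasma). -/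
open Matrix

noncomputable section

attribute [local instance] Matrix.normedAddCommGroup Matrix.normedSpace

theorem hasDerivAt_matrix_mul {l m n : Type*} [Fintype l] [Fintype m] [Fintype n]
    {A : ℝ → Matrix l m ℝ} {B : ℝ → Matrix m n ℝ} {A' : Matrix l m ℝ} {B' : Matrix m n ℝ} {s : ℝ}
    (hA : HasDerivAt A A' s) (hB : HasDerivAt B B' s) :
    HasDerivAt (fun u => A u * B u) (A' * B s + A s * B') s := by
  have hA' : ∀ i j, HasDerivAt (fun u => A u i j) (A' i j) s := fun i j =>
    hasDerivAt_pi.1 (hasDerivAt_pi.1 hA i) j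
  have hB' : ∀ i j, HasDerivAt (fun u => B u i j) (B' i j) s := fun i j =>
    hasDerivAt_pi.1 (hasDerivAt_pi.1 hB i) j
  refine hasDerivAt_pi.2 fun i => hasDerivAt_pi.2 fun j => ?_
  simp only [Matrix.mul_apply, Matrix.add_apply, ← Finset.sum_add_distrib]
  exact HasDerivAt.fun_sum fun k _ => (hA' i k).fun_mul (hB' k j)

theorem hasDerivAt_matrix_transpose {m n : Type*} [Fintype m] [Fintype n]
    {A : ℝ → Matrix m n ℝ} {A' : Matrix m n ℝ} {s : ℝ} (hA : HasDerivAt A A' s) :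
    HasDerivAt (fun u => (A u)ᵀ) A'ᵀ s :=
  hasDerivAt_pi.2 fun i => hasDerivAt_pi.2 fun j => hasDerivAt_pi.1 (hasDerivAt_pi.1 hA j) i

/-- The Wronskian of two solutions of a matrix Jacobi equation with symmetric potential,
in first-order form, has vanishing derivative. -/
theorem hasDerivAt_jacobi_wronskian {n : Type*} [Fintype n]
    {E₁ E₂ P₁ P₂ : ℝ → Matrix n n ℝ} {Z : Matrix n n ℝ} {a b s : ℝ} (hZ : Zᵀ = Z)
    (hE₁ : HasDerivAt E₁ (a • P₁ s) s) (hE₂ : HasDerivAt E₂ (a • P₂ s) s)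
    (hP₁ : HasDerivAt P₁ (b • (E₁ s * Z)) s) (hP₂ : HasDerivAt P₂ (b • (E₂ s * Z)) s) :
    HasDerivAt (fun u => P₁ u * (E₂ u)ᵀ - E₁ u * (P₂ u)ᵀ) 0 s := by
  have h := (hasDerivAt_matrix_mul hP₁ (hasDerivAt_matrix_transpose hE₂)).fun_sub
    (hasDerivAt_matrix_mul hE₁ (hasDerivAt_matrix_transpose hP₂))
  refine h.congr_deriv ?_
  simp only [Matrix.transpose_smul, Matrix.transpose_mul, hZ, Matrix.smul_mul, Matrix.mul_smul,
    Matrix.mul_assoc]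
  abel

theorem differentiable_of_smul {F : Type*} [NormedAddCommGroup F] [NormedSpace ℝ F]
    {w : ℝ → ℝ} {D : ℝ → F} (hw : Differentiable ℝ w) (hw0 : ∀ s, w s ≠ 0)
    (hD : Differentiable ℝ (fun s => w s • D s)) : Differentiable ℝ D := by
  have h : D = fun s => (w s)⁻¹ • (w s • D s) := by
    funext s
    rw [inv_smul_smul₀ (hw0 s)]
  rw [h]
  exact (hw.inv hw0).smul hD

/-- Conservation law for Jacobi matrices of light bundles in a plasma. -/
theorem plasma_jacobi_conservation
    (ωp : ℝ → ℝ) (hpos : ∀ s, 0 < ωp s)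
    (hω1 : Differentiable ℝ ωp) (hω2 : Differentiable ℝ (deriv ωp))
    (Z : ℝ → Matrix (Fin 2) (Fin 2) ℝ) (hZ : ∀ s, (Z s)ᵀ = Z s)
    (D₁ D₂ : ℝ → Matrix (Fin 2) (Fin 2) ℝ)
    (hD1d : Differentiable ℝ (fun s => ωp s • D₁ s))
    (hD1d2 : Differentiable ℝ (deriv (fun s => ωp s • D₁ s)))
    (hD2d : Differentiable ℝ (fun s => ωp s • D₂ s))
    (hD2d2 : Differentiable ℝ (deriv (fun s => ωp s • D₂ s)))
    (hJac1 : ∀ s, ((ωp s) ^ 2)⁻¹ •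
        deriv (fun t => ((ωp t) ^ 2)⁻¹ • deriv (fun u => ωp u • D₁ u) t) s
        = ωp s • (D₁ s * Z s))
    (hJac2 : ∀ s, ((ωp s) ^ 2)⁻¹ •
        deriv (fun t => ((ωp t) ^ 2)⁻¹ • deriv (fun u => ωp u • D₂ u) t) s
        = ωp s • (D₂ s * Z s)) :
    (∀ s, deriv (fun u => deriv D₁ u * (D₂ u)ᵀ - D₁ u * (deriv D₂ u)ᵀ) s = 0) ∧
    (∀ s t, deriv D₁ s * (D₂ s)ᵀ - D₁ s * (deriv D₂ s)ᵀ
          = deriv D₁ t * (D₂ t)ᵀ - D₁ t * (deriv D₂ t)ᵀ) := by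
  have hne : ∀ s, ωp s ≠ 0 := fun s => (hpos s).ne'
  have key : ∀ D : ℝ → Matrix (Fin 2) (Fin 2) ℝ,
      Differentiable ℝ (fun s => ωp s • D s) →
      Differentiable ℝ (deriv (fun s => ωp s • D s)) →
      (∀ s, ((ωp s) ^ 2)⁻¹ •
        deriv (fun t => ((ωp t) ^ 2)⁻¹ • deriv (fun u => ωp u • D u) t) s
        = ωp s • (D s * Z s)) →
      ∃ P : ℝ → Matrix (Fin 2) (Fin 2) ℝ, ∀ s,
        (ωp s) ^ 2 • P s = deriv ωp s • D s + ωp s • deriv D s ∧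
        HasDerivAt (fun u => ωp u • D u) ((ωp s) ^ 2 • P s) s ∧
        HasDerivAt P ((ωp s) ^ 2 • ((ωp s • D s) * Z s)) s := by
    intro D hd hd2 hJ
    refine ⟨fun t => ((ωp t) ^ 2)⁻¹ • deriv (fun u => ωp u • D u) t, fun s => ?_⟩
    have h2 : (ωp s) ^ 2 ≠ 0 := pow_ne_zero 2 (hne s)
    have hP : Differentiable ℝ fun t => ((ωp t) ^ 2)⁻¹ • deriv (fun u => ωp u • D u) t :=
      ((hω1.pow 2).inv fun t => pow_ne_zero 2 (hne t)).smul hd2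
    have hD := differentiable_of_smul hω1 hne hd
    refine ⟨?_, ?_, ?_⟩
    · rw [smul_inv_smul₀ h2, add_comm]
      exact ((hω1 s).hasDerivAt.fun_smul (hD s).hasDerivAt).deriv
    · rw [smul_inv_smul₀ h2]
      exact (hd s).hasDerivAt
    · rw [Matrix.smul_mul, ← hJ s, smul_inv_smul₀ h2]
      exact (hP s).hasDerivAt
  obtain ⟨P₁, h₁⟩ := key D₁ hD1d hD1d2 hJac1
  obtain ⟨P₂, h₂⟩ := key D₂ hD2d hD2d2 hJac2
  have hW : (fun u => deriv D₁ u * (D₂ u)ᵀ - D₁ u * (deriv D₂ u)ᵀ) =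
      fun u => P₁ u * (ωp u • D₂ u)ᵀ - (ωp u • D₁ u) * (P₂ u)ᵀ := by
    funext u
    apply smul_right_injective _ (pow_ne_zero 2 (hne u))
    simp only [smul_sub]
    rw [← Matrix.smul_mul _ (P₁ u), ← Matrix.mul_smul _ _ (P₂ u)ᵀ, ← Matrix.transpose_smul,
      (h₁ u).1, (h₂ u).1]
    simp only [Matrix.transpose_add, Matrix.transpose_smul, Matrix.add_mul, Matrix.mul_add,
      Matrix.smul_mul, Matrix.mul_smul]
    module
  have hderiv : ∀ s, HasDerivAt
      (fun u => deriv D₁ u * (D₂ u)ᵀ - D₁ u * (deriv D₂ u)ᵀ) 0 s := fun s => by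
    rw [hW]
    exact hasDerivAt_jacobi_wronskian (hZ s) (h₁ s).2.1 (h₂ s).2.1 (h₁ s).2.2 (h₂ s).2.2
  exact ⟨fun s => (hderiv s).deriv, is_const_of_deriv_eq_zero
    (fun s => (hderiv s).differentiableAt) fun s => (hderiv s).deriv⟩
end
end

section
/- Let D : ℝ → M₂(ℝ) be differentiable such that the function s ↦ D'(s)·D(s)ᵀ − D(s)·D'(s)ᵀ is constant on ℝ, and suppose there exists s₀ with D(s₀) = 0 (a homocentric bundle). Then D'(s)·D(s)ᵀ = D(s)·D'(s)ᵀ for all s; consequently, at every s where D(s) is invertible, the deformation matrix S(s) = D(s)⁻¹·D'(s) is symmetric, i.e. the twist Ω of the bundle (the antisymmetric part of S) vanishes: a homocentric bundle is twistfree. -/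
open Matrix

noncomputable section

attribute [local instance] Matrix.normedAddCommGroup Matrix.normedSpace

/-- A homocentric bundle is twistfree. -/
theorem homocentric_bundle_twistfree
    (D : ℝ → Matrix (Fin 2) (Fin 2) ℝ)
    (hD : Differentiable ℝ D)
    (hconst : ∀ s t : ℝ,
      deriv D s * (D s)ᵀ - D s * (deriv D s)ᵀ
        = deriv D t * (D t)ᵀ - D t * (deriv D t)ᵀ)
    (hvertex : ∃ s₀ : ℝ, D s₀ = 0) :
    (∀ s, deriv D s * (D s)ᵀ = D s * (deriv D s)ᵀ) ∧
    (∀ s, IsUnit (D s) → ((D s)⁻¹ * deriv D s)ᵀ = (D s)⁻¹ * deriv D s) := by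
  obtain ⟨s₀, h₀⟩ := hvertex
  have key : ∀ s, deriv D s * (D s)ᵀ = D s * (deriv D s)ᵀ := fun s =>
    sub_eq_zero.mp (by simpa [h₀] using hconst s s₀)
  refine ⟨key, fun s hs => ?_⟩
  have hdet : IsUnit (D s).det := (isUnit_iff_isUnit_det _).mp hs
  have hdet' : IsUnit ((D s)ᵀ).det := by rwa [det_transpose]
  calc ((D s)⁻¹ * deriv D s)ᵀ
      = (D s)⁻¹ * (D s * (deriv D s)ᵀ) * ((D s)ᵀ)⁻¹ := by
        rw [nonsing_inv_mul_cancel_left _ _ hdet, transpose_mul, transpose_nonsing_inv]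
    _ = (D s)⁻¹ * deriv D s := by
        rw [← key s, ← Matrix.mul_assoc, mul_nonsing_inv_cancel_right _ _ hdet']
end
end

section
/- (Reciprocity theorem in a plasma.) Let ω_p : ℝ → ℝ be positive and twice differentiable, Z̃ : ℝ → M₂(ℝ) symmetric-valued, and let D₁, D₂ : ℝ → M₂(ℝ) be twice differentiable with ω_p·Dᵢ satisfying ω_p(s)⁻² · d/ds ( ω_p(s)⁻² · d/ds ( ω_p(s)·Dᵢ(s) ) ) = ω_p(s)·Dᵢ(s)·Z̃(s) for all s. Assume the vertex conditions D₁(s₁) = 0, D₁'(s₁) = −c₁·𝟙 and D₂(s₂) = 0, D₂'(s₂) = c₂·𝟙, with positive constants c₁, c₂ and 𝟙 the identity matrix. Then c₁·D₂(s₁)ᵀ = c₂·D₁(s₂); taking determinants, c₁·√|det D₂(s₁)| = c₂·√|det D₁(s₂)|. -/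
open Matrix

noncomputable section

attribute [local instance] Matrix.normedAddCommGroup Matrix.normedSpace

theorem hasDerivAt_matrix_apply {m n : Type*} [Fintype m] [Fintype n]
    {A : ℝ → Matrix m n ℝ} {A' : Matrix m n ℝ} {s : ℝ} (h : HasDerivAt A A' s) (i : m) (j : n) :
    HasDerivAt (fun t => A t i j) (A' i j) s :=
  hasDerivAt_pi.1 (hasDerivAt_pi.1 h i) j

/-- The Wronskian `P₁ A₂ᵀ - A₁ P₂ᵀ` of two solutions of the Jacobi system `A' = w P`,
`P' = w A Z` with symmetric `Z` is constant. -/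
theorem jacobi_wronskian_const {n : Type*} [Fintype n] {w : ℝ → ℝ} {Z : ℝ → Matrix n n ℝ}
    (hZ : ∀ s, (Z s)ᵀ = Z s) {A₁ A₂ P₁ P₂ : ℝ → Matrix n n ℝ}
    (hA₁ : ∀ s, HasDerivAt A₁ (w s • P₁ s) s) (hA₂ : ∀ s, HasDerivAt A₂ (w s • P₂ s) s)
    (hP₁ : ∀ s, HasDerivAt P₁ (w s • (A₁ s * Z s)) s)
    (hP₂ : ∀ s, HasDerivAt P₂ (w s • (A₂ s * Z s)) s) (s t : ℝ) :
    P₁ s * (A₂ s)ᵀ - A₁ s * (P₂ s)ᵀ = P₁ t * (A₂ t)ᵀ - A₁ t * (P₂ t)ᵀ := by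
  ext i j
  have key : ∀ s, HasDerivAt (fun s => (P₁ s * (A₂ s)ᵀ - A₁ s * (P₂ s)ᵀ) i j) 0 s := by
    intro s
    have h := (HasDerivAt.fun_sum (u := Finset.univ) fun k _ =>
      (hasDerivAt_matrix_apply (hP₁ s) i k).fun_mul (hasDerivAt_matrix_apply (hA₂ s) j k)).fun_sub
      (HasDerivAt.fun_sum (u := Finset.univ) fun k _ =>
      (hasDerivAt_matrix_apply (hA₁ s) i k).fun_mul (hasDerivAt_matrix_apply (hP₂ s) j k))
    refine h.congr_deriv ?_
    have hsymm : (A₁ s * Z s * (A₂ s)ᵀ) i j = (A₁ s * (A₂ s * Z s)ᵀ) i j := by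
      rw [transpose_mul, hZ, Matrix.mul_assoc]
    rw [Matrix.mul_apply, Matrix.mul_apply] at hsymm
    simp only [transpose_apply] at hsymm
    simp only [Matrix.smul_apply, smul_eq_mul, Finset.sum_add_distrib, mul_assoc,
      mul_left_comm _ (w s), ← Finset.mul_sum]
    rw [hsymm]
    ring
  exact is_const_of_deriv_eq_zero (fun s => (key s).differentiableAt) (fun s => (key s).deriv) s t

/-- The Jacobi equation of `ω • D` with respect to the rescaled parameter, as a first-order
system. -/
theorem hasDerivAt_jacobi_system {n : Type*} [Fintype n] {ω : ℝ → ℝ} (hpos : ∀ s, 0 < ω s)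
    (hω : Differentiable ℝ ω) (hω' : Differentiable ℝ (deriv ω)) {Z D : ℝ → Matrix n n ℝ}
    (hD : Differentiable ℝ D) (hD' : Differentiable ℝ (deriv D))
    (hJac : ∀ s, ((ω s) ^ 2)⁻¹ • deriv (fun t => ((ω t) ^ 2)⁻¹ • deriv (fun u => ω u • D u) t) s
        = ω s • (D s * Z s)) (s : ℝ) :
    HasDerivAt (fun u => ω u • D u)
      ((ω s) ^ 2 • ((ω s) ^ 2)⁻¹ • deriv (fun u => ω u • D u) s) s ∧
    HasDerivAt (fun t => ((ω t) ^ 2)⁻¹ • deriv (fun u => ω u • D u) t)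
      ((ω s) ^ 2 • (ω s • D s * Z s)) s := by
  have hne : ∀ s, (ω s) ^ 2 ≠ 0 := fun s => (pow_pos (hpos s) 2).ne'
  have hderiv : deriv (fun u => ω u • D u) = fun t => ω t • deriv D t + deriv ω t • D t :=
    funext fun t => deriv_fun_smul (hω t) (hD t)
  constructor
  · rw [smul_inv_smul₀ (hne s)]
    exact ((hω s).fun_smul (hD s)).hasDerivAt
  · rw [Matrix.smul_mul, ← hJac s, smul_inv_smul₀ (hne s)]
    refine DifferentiableAt.hasDerivAt ?_
    rw [hderiv]
    exact (((hω s).fun_pow 2).fun_inv (hne s)).fun_smul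
      (((hω s).fun_smul (hD' s)).fun_add ((hω' s).fun_smul (hD s)))

/-- Reciprocity theorem (Etherington law) for light bundles in a plasma. -/
theorem plasma_reciprocity
    (ωp : ℝ → ℝ) (hpos : ∀ s, 0 < ωp s)
    (hω1 : Differentiable ℝ ωp) (hω2 : Differentiable ℝ (deriv ωp))
    (Z : ℝ → Matrix (Fin 2) (Fin 2) ℝ) (hZ : ∀ s, (Z s)ᵀ = Z s)
    (D₁ D₂ : ℝ → Matrix (Fin 2) (Fin 2) ℝ)
    (hD1 : Differentiable ℝ D₁) (hD1' : Differentiable ℝ (deriv D₁))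
    (hD2 : Differentiable ℝ D₂) (hD2' : Differentiable ℝ (deriv D₂))
    (hJac1 : ∀ s, ((ωp s) ^ 2)⁻¹ •
        deriv (fun t => ((ωp t) ^ 2)⁻¹ • deriv (fun u => ωp u • D₁ u) t) s
        = ωp s • (D₁ s * Z s))
    (hJac2 : ∀ s, ((ωp s) ^ 2)⁻¹ •
        deriv (fun t => ((ωp t) ^ 2)⁻¹ • deriv (fun u => ωp u • D₂ u) t) s
        = ωp s • (D₂ s * Z s))
    (s₁ s₂ : ℝ) (c₁ c₂ : ℝ) (hc₁ : 0 < c₁) (hc₂ : 0 < c₂)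
    (hv1 : D₁ s₁ = 0) (hv1' : deriv D₁ s₁ = -c₁ • (1 : Matrix (Fin 2) (Fin 2) ℝ))
    (hv2 : D₂ s₂ = 0) (hv2' : deriv D₂ s₂ = c₂ • (1 : Matrix (Fin 2) (Fin 2) ℝ)) :
    c₁ • (D₂ s₁)ᵀ = c₂ • D₁ s₂ ∧
    c₁ * Real.sqrt |(D₂ s₁).det| = c₂ * Real.sqrt |(D₁ s₂).det| := by
  have hmom : ∀ {D : ℝ → Matrix (Fin 2) (Fin 2) ℝ} {s c : ℝ}, Differentiable ℝ D → D s = 0 →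
      deriv D s = c • (1 : Matrix (Fin 2) (Fin 2) ℝ) →
      ((ωp s) ^ 2)⁻¹ • deriv (fun u => ωp u • D u) s
        = ((ωp s)⁻¹ * c) • (1 : Matrix (Fin 2) (Fin 2) ℝ) := by
    intro D s c hD h0 h1
    have := (hpos s).ne'
    have hderiv : deriv (fun u => ωp u • D u) s = ωp s • deriv D s + deriv ωp s • D s :=
      deriv_fun_smul (hω1 s) (hD s)
    rw [hderiv, h0, h1, smul_zero, add_zero, smul_smul, smul_smul]
    congr 1
    field_simp
  have hsys₁ := hasDerivAt_jacobi_system hpos hω1 hω2 hD1 hD1' hJac1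
  have hsys₂ := hasDerivAt_jacobi_system hpos hω1 hω2 hD2 hD2' hJac2
  have hW := jacobi_wronskian_const hZ (fun s => (hsys₁ s).1) (fun s => (hsys₂ s).1)
    (fun s => (hsys₁ s).2) (fun s => (hsys₂ s).2) s₁ s₂
  have hmat : c₁ • (D₂ s₁)ᵀ = c₂ • D₁ s₂ := by
    have h₁ := (hpos s₁).ne'
    have h₂ := (hpos s₂).ne'
    simp only [hmom hD1 hv1 hv1', hmom hD2 hv2 hv2', hv1, hv2, smul_zero, transpose_zero,
      Matrix.mul_zero, Matrix.zero_mul, sub_zero, zero_sub, transpose_smul, transpose_one,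
      Matrix.smul_mul, Matrix.mul_smul, Matrix.one_mul, Matrix.mul_one, smul_smul] at hW
    rw [show ωp s₁ * ((ωp s₁)⁻¹ * -c₁) = -c₁ by field_simp,
      show (ωp s₂)⁻¹ * c₂ * ωp s₂ = c₂ by field_simp, neg_smul] at hW
    exact neg_injective hW
  refine ⟨hmat, ?_⟩
  have hdet := congrArg (fun M => Real.sqrt |M.det|) hmat
  simpa [Matrix.det_smul, abs_mul, Real.sqrt_sq, hc₁.le, hc₂.le] using hdet
end
end

section
/- Let 0 ≤ ω_pe < ω_e and 0 ≤ ω_pr < ω_r be real numbers, and let d₁, d₂ ≥ 0 be reals satisfying the determinant reciprocity relation ω_r²·d₂ = ω_e²·d₁. Define the area distance D_A = √( d₁·(1 − ω_pr²/ω_r²) ), the corrected luminosity distance D_{L,corr} = √( d₂·(1 − ω_pe²/ω_e²) ), and the luminosity distance D_L = (ω_e/ω_r)·D_{L,corr}. Then D_L = (ω_e/ω_r) · √( (ω_e² − ω_pe²)/(ω_r² − ω_pr²) ) · D_A, i.e. in a plasma the luminosity distance and the area distance are related by a frequency ratio times a wavelength ratio rather than by a redshift factor squared. -/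
/-- Relation between luminosity distance and area distance in a plasma:
a frequency ratio times a wavelength ratio. -/
theorem plasma_distance_relation
    (ωe ωr ωpe ωpr d₁ d₂ : ℝ)
    (hpe : 0 ≤ ωpe) (hee : ωpe < ωe)
    (hpr : 0 ≤ ωpr) (hrr : ωpr < ωr)
    (hd₁ : 0 ≤ d₁) (hd₂ : 0 ≤ d₂)
    (hreci : ωr ^ 2 * d₂ = ωe ^ 2 * d₁)
    (DA DLcorr DL : ℝ)
    (hDA : DA = Real.sqrt (d₁ * (1 - ωpr ^ 2 / ωr ^ 2)))
    (hDLcorr : DLcorr = Real.sqrt (d₂ * (1 - ωpe ^ 2 / ωe ^ 2)))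
    (hDL : DL = (ωe / ωr) * DLcorr) :
    DL = (ωe / ωr) * Real.sqrt ((ωe ^ 2 - ωpe ^ 2) / (ωr ^ 2 - ωpr ^ 2)) * DA := by
  have he : 0 < ωe := hpe.trans_lt hee
  have hr : 0 < ωr := hpr.trans_lt hrr
  have he' : 0 < ωe ^ 2 - ωpe ^ 2 := by nlinarith
  have hr' : 0 < ωr ^ 2 - ωpr ^ 2 := by nlinarith
  have hd : d₂ = ωe ^ 2 * d₁ / ωr ^ 2 := by
    rw [eq_div_iff (by positivity), ← hreci, mul_comm]
  rw [hDL, hDLcorr, hDA, mul_assoc, ← Real.sqrt_mul (by positivity), hd]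
  congr 2
  have hr'' := hr'.ne'
  field_simp
end

section
/- Let θ, Ω, σ₁, σ₂ : ℝ → ℝ be differentiable, define the deformation matrix S(s) = θ(s)·𝟙 + [[σ₁(s), σ₂(s)], [σ₂(s), −σ₁(s)]] + Ω(s)·[[0, −1], [1, 0]], and suppose S'(s) + S(s)·S(s) = Z(s) for all s, where Z(s) ∈ M₂(ℝ) is symmetric for each s. Then the complex shear σ = σ₁ + iσ₂ satisfies the second Sachs equation dσ/ds + 2θσ = (Z₁₁ − Z₂₂)/2 + i·Z₁₂. -/
open Matrix Complex

noncomputable section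

attribute [local instance] Matrix.normedAddCommGroup Matrix.normedSpace

theorem hasDerivAt_matrix {m n : Type*} [Fintype m] [Fintype n]
    {A : ℝ → Matrix m n ℝ} {A' : Matrix m n ℝ} {s : ℝ}
    (h : ∀ i j, HasDerivAt (fun u => A u i j) (A' i j) s) : HasDerivAt A A' s :=
  hasDerivAt_pi.2 fun i => hasDerivAt_pi.2 fun j => h i j

/-- The second Sachs equation for the complex shear σ = σ₁ + iσ₂. -/
theorem second_sachs_equation
    (θ Ω σ₁ σ₂ : ℝ → ℝ)
    (hθ : Differentiable ℝ θ) (hΩ : Differentiable ℝ Ω)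
    (hσ₁ : Differentiable ℝ σ₁) (hσ₂ : Differentiable ℝ σ₂)
    (S : ℝ → Matrix (Fin 2) (Fin 2) ℝ)
    (hS : ∀ s, S s = θ s • (1 : Matrix (Fin 2) (Fin 2) ℝ)
        + !![σ₁ s, σ₂ s; σ₂ s, -σ₁ s]
        + Ω s • !![0, -1; 1, 0])
    (Z : ℝ → Matrix (Fin 2) (Fin 2) ℝ) (hZ : ∀ s, (Z s)ᵀ = Z s)
    (hSachs : ∀ s, deriv S s + S s * S s = Z s) :
    ∀ s, deriv (fun u => (σ₁ u : ℂ) + Complex.I * σ₂ u) s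
        + 2 * (θ s : ℂ) * ((σ₁ s : ℂ) + Complex.I * σ₂ s)
      = ((Z s 0 0 - Z s 1 1) / 2 : ℝ) + Complex.I * (Z s 0 1 : ℝ) := by
  intro s
  have h1 := (hσ₁ s).hasDerivAt
  have h2 := (hσ₂ s).hasDerivAt
  have h3 := (hθ s).hasDerivAt
  have h4 := (hΩ s).hasDerivAt
  have hS' : HasDerivAt S
      !![deriv θ s + deriv σ₁ s, deriv σ₂ s - deriv Ω s;
        deriv σ₂ s + deriv Ω s, deriv θ s - deriv σ₁ s] s := by
    refine hasDerivAt_matrix fun i j => ?_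
    simp only [hS]
    fin_cases i <;> fin_cases j
    · simpa using h3.fun_add h1
    · simpa [sub_eq_add_neg] using h2.fun_sub h4
    · simpa using h2.fun_add h4
    · simpa [sub_eq_add_neg] using h3.fun_sub h1
  have hσ : HasDerivAt (fun u => (σ₁ u : ℂ) + Complex.I * σ₂ u)
      ((deriv σ₁ s : ℝ) + Complex.I * (deriv σ₂ s : ℝ)) s :=
    h1.ofReal_comp.fun_add (h2.ofReal_comp.const_mul Complex.I)
  have hE := hSachs s
  have hderiv : deriv S s = !![deriv θ s + deriv σ₁ s, deriv σ₂ s - deriv Ω s;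
      deriv σ₂ s + deriv Ω s, deriv θ s - deriv σ₁ s] := hS'.deriv
  rw [hderiv, hS] at hE
  have h00 := congrFun (congrFun hE 0) 0
  have h01 := congrFun (congrFun hE 0) 1
  have h10 := congrFun (congrFun hE 1) 0
  have h11 := congrFun (congrFun hE 1) 1
  have hsymm : Z s 1 0 = Z s 0 1 := congrFun (congrFun (hZ s) 0) 1
  simp [Matrix.mul_apply, Fin.sum_univ_two] at h00 h01 h10 h11
  have hre : deriv σ₁ s + 2 * θ s * σ₁ s = (Z s 0 0 - Z s 1 1) / 2 := by
    linear_combination (h00 - h11) / 2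
  have him : deriv σ₂ s + 2 * θ s * σ₂ s = Z s 0 1 := by
    linear_combination (h01 + h10 + hsymm) / 2
  rw [hσ.deriv, ← hre, ← him]
  push_cast
  ring
end
end

section
/- Let D₊, D₋, ψ, χ, θ, Ω, σ₁, σ₂ : ℝ → ℝ be differentiable, let R(φ) = [[cos φ, −sin φ], [sin φ, cos φ]], set D(s) = R(ψ(s))·diag(D₊(s), D₋(s))·R(−χ(s)) and S(s) = θ(s)·𝟙 + [[σ₁(s), σ₂(s)], [σ₂(s), −σ₁(s)]] + Ω(s)·[[0, −1], [1, 0]]. If D'(s) = D(s)·S(s) for all s, then with ρ = θ + iΩ and σ = σ₁ + iσ₂ the following complex equation holds for each choice of sign: dD±/ds + i·D±·dχ/ds − i·D∓·dψ/ds = D±·( ρ̄ ± σ·e^{−2iχ} ), where ρ̄ denotes the complex conjugate of ρ. -/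
open Matrix Complex

noncomputable section

attribute [local instance] Matrix.normedAddCommGroup Matrix.normedSpace

/-- A rotation of the plane has trivial kernel. -/
theorem eq_zero_of_rotation_eq_zero {c s x y : ℝ} (h : c ^ 2 + s ^ 2 = 1)
    (hx : c * x - s * y = 0) (hy : s * x + c * y = 0) : x = 0 ∧ y = 0 := by
  constructor
  · linear_combination c * hx + s * hy - x * h
  · linear_combination c * hy - s * hx - y * h

/-- The derivative of a curve of `2 × 2` matrices is computed entrywise. -/
theorem hasDerivAt_matrix_fin_two {a b c d : ℝ → ℝ} {a' b' c' d' s : ℝ}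
    (ha : HasDerivAt a a' s) (hb : HasDerivAt b b' s)
    (hc : HasDerivAt c c' s) (hd : HasDerivAt d d' s) :
    HasDerivAt (fun t => !![a t, b t; c t, d t]) !![a', b'; c', d'] s := by
  refine hasDerivAt_pi.2 fun i => hasDerivAt_pi.2 fun j => ?_
  fin_cases i <;> fin_cases j
  exacts [ha, hb, hc, hd]

theorem exp_neg_two_I_mul_ofReal (x : ℝ) :
    Complex.exp (-2 * Complex.I * (x : ℂ)) =
      ((Real.cos x ^ 2 - Real.sin x ^ 2 : ℝ) : ℂ)
        - Complex.I * ((2 * Real.sin x * Real.cos x : ℝ) : ℂ) := by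
  have h : -2 * Complex.I * (x : ℂ) = ((-(2 * x) : ℝ) : ℂ) * Complex.I := by
    push_cast
    ring
  rw [h, Complex.exp_mul_I, ← Complex.ofReal_cos, ← Complex.ofReal_sin, Real.cos_neg,
    Real.sin_neg, Real.cos_two_mul', Real.sin_two_mul]
  push_cast
  ring

/-- Evolution of the eigenvalues and angles of the polar decomposition of the
Jacobi matrix in terms of the complex optical scalars ρ = θ + iΩ, σ = σ₁ + iσ₂. -/
theorem polar_jacobi_evolution
    (Dp Dm ψ χ θ Ω σ₁ σ₂ : ℝ → ℝ)
    (hDp : Differentiable ℝ Dp) (hDm : Differentiable ℝ Dm)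
    (hψ : Differentiable ℝ ψ) (hχ : Differentiable ℝ χ)
    (hθ : Differentiable ℝ θ) (hΩ : Differentiable ℝ Ω)
    (hσ₁ : Differentiable ℝ σ₁) (hσ₂ : Differentiable ℝ σ₂)
    (R : ℝ → Matrix (Fin 2) (Fin 2) ℝ)
    (hR : ∀ φ, R φ = !![Real.cos φ, -Real.sin φ; Real.sin φ, Real.cos φ])
    (D S : ℝ → Matrix (Fin 2) (Fin 2) ℝ)
    (hD : ∀ s, D s = R (ψ s) * !![Dp s, 0; 0, Dm s] * R (-χ s))
    (hS : ∀ s, S s = θ s • (1 : Matrix (Fin 2) (Fin 2) ℝ)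
        + !![σ₁ s, σ₂ s; σ₂ s, -σ₁ s]
        + Ω s • !![0, -1; 1, 0])
    (hdef : ∀ s, deriv D s = D s * S s) :
    ∀ s,
      (Complex.ofReal (deriv Dp s)
          + Complex.I * Complex.ofReal (Dp s) * Complex.ofReal (deriv χ s)
          - Complex.I * Complex.ofReal (Dm s) * Complex.ofReal (deriv ψ s)
        = Complex.ofReal (Dp s) *
          ((starRingEnd ℂ) ((θ s : ℂ) + Complex.I * Ω s)
            + ((σ₁ s : ℂ) + Complex.I * σ₂ s)
              * Complex.exp (-2 * Complex.I * (χ s : ℂ)))) ∧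
      (Complex.ofReal (deriv Dm s)
          + Complex.I * Complex.ofReal (Dm s) * Complex.ofReal (deriv χ s)
          - Complex.I * Complex.ofReal (Dp s) * Complex.ofReal (deriv ψ s)
        = Complex.ofReal (Dm s) *
          ((starRingEnd ℂ) ((θ s : ℂ) + Complex.I * Ω s)
            - ((σ₁ s : ℂ) + Complex.I * σ₂ s)
              * Complex.exp (-2 * Complex.I * (χ s : ℂ)))) := by
  intro s
  have hDeq : D = fun t => !![
      Real.cos (ψ t) * Dp t * Real.cos (χ t) + Real.sin (ψ t) * Dm t * Real.sin (χ t),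
      Real.cos (ψ t) * Dp t * Real.sin (χ t) - Real.sin (ψ t) * Dm t * Real.cos (χ t);
      Real.sin (ψ t) * Dp t * Real.cos (χ t) - Real.cos (ψ t) * Dm t * Real.sin (χ t),
      Real.sin (ψ t) * Dp t * Real.sin (χ t) + Real.cos (ψ t) * Dm t * Real.cos (χ t)] := by
    funext t
    rw [hD, hR, hR]
    ext i j
    fin_cases i <;> fin_cases j <;>
      simp [Matrix.mul_apply, Fin.sum_univ_two] <;> ring
  have hp := (hDp s).hasDerivAt
  have hm := (hDm s).hasDerivAt
  have hcψ := (hψ s).hasDerivAt.cos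
  have hsψ := (hψ s).hasDerivAt.sin
  have hcχ := (hχ s).hasDerivAt.cos
  have hsχ := (hχ s).hasDerivAt.sin
  have hderiv := hasDerivAt_matrix_fin_two
    (((hcψ.mul hp).mul hcχ).add ((hsψ.mul hm).mul hsχ))
    (((hcψ.mul hp).mul hsχ).sub ((hsψ.mul hm).mul hcχ))
    (((hsψ.mul hp).mul hcχ).sub ((hcψ.mul hm).mul hsχ))
    (((hsψ.mul hp).mul hsχ).add ((hcψ.mul hm).mul hcχ))
  have hdef_s := hdef s
  rw [hS, hDeq] at hdef_s
  have hE := hderiv.deriv.symm.trans hdef_s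
  have h00 := congrFun (congrFun hE 0) 0
  have h01 := congrFun (congrFun hE 0) 1
  have h10 := congrFun (congrFun hE 1) 0
  have h11 := congrFun (congrFun hE 1) 1
  simp [Matrix.mul_apply, Fin.sum_univ_two] at h00 h01 h10 h11
  have hψ1 := Real.cos_sq_add_sin_sq (ψ s)
  have hχ1 := Real.cos_sq_add_sin_sq (χ s)
  rw [exp_neg_two_I_mul_ofReal]
  generalize Real.cos (ψ s) = a at *
  generalize Real.sin (ψ s) = b at *
  generalize Real.cos (χ s) = c at *
  generalize Real.sin (χ s) = d at *
  generalize deriv Dp s = p' at *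
  generalize deriv Dm s = m' at *
  generalize deriv ψ s = u at *
  generalize deriv χ s = v at *
  obtain ⟨y00, y10⟩ := eq_zero_of_rotation_eq_zero hψ1
    (x := p' * c - (Dp s * v - Dm s * u) * d
      - Dp s * (c * (θ s + σ₁ s) + d * (σ₂ s + Ω s)))
    (y := (Dp s * u - Dm s * v) * c - m' * d
      - Dm s * (-d * (θ s + σ₁ s) + c * (σ₂ s + Ω s)))
    (by linear_combination h00) (by linear_combination h10)
  obtain ⟨y01, y11⟩ := eq_zero_of_rotation_eq_zero hψ1
    (x := p' * d + (Dp s * v - Dm s * u) * c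
      - Dp s * (c * (σ₂ s - Ω s) + d * (θ s - σ₁ s)))
    (y := (Dp s * u - Dm s * v) * d + m' * c
      - Dm s * (-d * (σ₂ s - Ω s) + c * (θ s - σ₁ s)))
    (by linear_combination h01) (by linear_combination h11)
  constructor <;> apply Complex.ext <;> simp [pow_two]
  · linear_combination c * y00 + d * y01 - (p' - Dp s * θ s) * hχ1
  · linear_combination c * y01 - d * y00 - (Dp s * v - Dm s * u + Dp s * Ω s) * hχ1
  · linear_combination c * y11 - d * y10 - (m' - Dm s * θ s) * hχ1
  · linear_combination -c * y10 - d * y11 + (Dp s * u - Dm s * v - Dm s * Ω s) * hχ1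
end
end

section
/- Let a : ℝ → ℝ be positive and differentiable (the scale factor), ω_p : ℝ → ℝ differentiable (the plasma frequency), and k ∈ ℝ. Let t, r, p_t, p_r : ℝ → ℝ be differentiable functions of the curve parameter s satisfying Hamilton's equations for a radial light ray in a spatially homogeneous plasma on a Robertson–Walker spacetime: dt/ds = −p_t, dr/ds = (1 − k r²)·p_r/a(t)², dp_t/ds = (a'(t)/a(t)³)·(1 − k r²)·p_r² − ω_p(t)·ω_p'(t), dp_r/ds = k·r·p_r²/a(t)², together with the constraint −p_t² + (1 − k r²)·p_r²/a(t)² + ω_p(t)² = 0 for all s. Then the function s ↦ a(t(s))²·( p_t(s)² − ω_p(t(s))² ) is constant along the ray; equivalently, C = a(t)·√(ω² − ω_p(t)²) with frequency ω = −p_t is a constant of motion. -/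
/-- Constant of motion for a radial light ray in a spatially homogeneous plasma
on a Robertson–Walker spacetime: `a(t)²(p_t² − ω_p(t)²)`, i.e. `C = a√(ω² − ω_p²)`
with `ω = −p_t`, is constant along the ray. -/
theorem RW_plasma_constant_of_motion
    (a ωp : ℝ → ℝ) (ha_pos : ∀ u, 0 < a u)
    (ha : Differentiable ℝ a) (hωp : Differentiable ℝ ωp)
    (k : ℝ)
    (t r pt pr : ℝ → ℝ)
    (ht : Differentiable ℝ t) (hr : Differentiable ℝ r)
    (hpt : Differentiable ℝ pt) (hpr : Differentiable ℝ pr)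
    (heq1 : ∀ s, deriv t s = -pt s)
    (heq2 : ∀ s, deriv r s = (1 - k * r s ^ 2) * pr s / (a (t s)) ^ 2)
    (heq3 : ∀ s, deriv pt s
        = (deriv a (t s) / (a (t s)) ^ 3) * (1 - k * r s ^ 2) * pr s ^ 2
          - ωp (t s) * deriv ωp (t s))
    (heq4 : ∀ s, deriv pr s = k * r s * pr s ^ 2 / (a (t s)) ^ 2)
    (hconstraint : ∀ s,
        -pt s ^ 2 + (1 - k * r s ^ 2) * pr s ^ 2 / (a (t s)) ^ 2
          + ωp (t s) ^ 2 = 0) :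
    ∀ s₁ s₂ : ℝ,
      a (t s₁) ^ 2 * (pt s₁ ^ 2 - ωp (t s₁) ^ 2)
        = a (t s₂) ^ 2 * (pt s₂ ^ 2 - ωp (t s₂) ^ 2) := by
  have key : ∀ s, HasDerivAt
      (fun s => a (t s) ^ 2 * (pt s ^ 2 - ωp (t s) ^ 2)) 0 s := by
    intro s
    have h1 : HasDerivAt t (-pt s) s := heq1 s ▸ (ht s).hasDerivAt
    have h2 : HasDerivAt (fun s => a (t s)) (deriv a (t s) * -pt s) s :=
      (ha (t s)).hasDerivAt.comp s h1
    have h3 : HasDerivAt (fun s => ωp (t s)) (deriv ωp (t s) * -pt s) s :=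
      (hωp (t s)).hasDerivAt.comp s h1
    have hne : a (t s) ≠ 0 := (ha_pos (t s)).ne'
    have h4 : deriv pt s = deriv a (t s) / a (t s) * (pt s ^ 2 - ωp (t s) ^ 2)
        - ωp (t s) * deriv ωp (t s) := by
      have hc : pt s ^ 2 - ωp (t s) ^ 2
          = (1 - k * r s ^ 2) * pr s ^ 2 / a (t s) ^ 2 := by
        linarith [hconstraint s]
      rw [heq3 s, hc]
      field_simp
    have h5 := (h2.fun_pow 2).fun_mul (((hpt s).hasDerivAt.fun_pow 2).fun_sub (h3.fun_pow 2))
    refine h5.congr_deriv ?_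
    rw [h4]
    field_simp
    push_cast
    ring
  exact is_const_of_deriv_eq_zero (fun s => (key s).differentiableAt) (fun s => (key s).deriv)
end

section
/- Let ω_e, ω_r, ω_pe, ω_pr be real numbers with 0 ≤ ω_pe < ω_e and 0 ≤ ω_pr < ω_r. Define the wavelengths λ_e = 2π/√(ω_e² − ω_pe²) and λ_r = 2π/√(ω_r² − ω_pr²) via the plasma dispersion relation, the wavelength redshift z = (λ_r − λ_e)/λ_e and the frequency redshift Z = (ω_e − ω_r)/ω_r. Then 1 + Z = (1 + z) · √( 1 + (1/ω_r²)·( ω_pe²/(1 + z)² − ω_pr² ) ). -/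
/-- Relation between the frequency redshift Z and the wavelength redshift z
in a cold plasma. -/
theorem plasma_frequency_wavelength_redshift
    (ωe ωr ωpe ωpr : ℝ)
    (hpe : 0 ≤ ωpe) (hee : ωpe < ωe)
    (hpr : 0 ≤ ωpr) (hrr : ωpr < ωr)
    (lame lamr z Z : ℝ)
    (hlame : lame = 2 * Real.pi / Real.sqrt (ωe ^ 2 - ωpe ^ 2))
    (hlamr : lamr = 2 * Real.pi / Real.sqrt (ωr ^ 2 - ωpr ^ 2))
    (hz : z = (lamr - lame) / lame)
    (hZ : Z = (ωe - ωr) / ωr) :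
    1 + Z = (1 + z) *
      Real.sqrt (1 + (1 / ωr ^ 2) * (ωpe ^ 2 / (1 + z) ^ 2 - ωpr ^ 2)) := by
  have hωe : 0 < ωe := hpe.trans_lt hee
  have hωr : 0 < ωr := hpr.trans_lt hrr
  have he : 0 < ωe ^ 2 - ωpe ^ 2 := by nlinarith
  have hr : 0 < ωr ^ 2 - ωpr ^ 2 := by nlinarith
  have hA := Real.sqrt_pos.2 he
  have hB := Real.sqrt_pos.2 hr
  have hA2 := Real.sq_sqrt he.le
  have hB2 := Real.sq_sqrt hr.le
  set A := Real.sqrt (ωe ^ 2 - ωpe ^ 2)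
  set B := Real.sqrt (ωr ^ 2 - ωpr ^ 2)
  have hπ := Real.pi_pos
  have hz1 : 1 + z = A / B := by
    rw [hz, hlame, hlamr]
    field_simp
    ring
  have hrad : 1 + (1 / ωr ^ 2) * (ωpe ^ 2 / (A / B) ^ 2 - ωpr ^ 2) =
      (B * ωe / (A * ωr)) ^ 2 := by
    have hpe2 : ωpe ^ 2 = ωe ^ 2 - A ^ 2 := by linarith
    have hpr2 : ωpr ^ 2 = ωr ^ 2 - B ^ 2 := by linarith
    rw [hpe2, hpr2]
    field_simp
    ring
  rw [hz1, hrad, Real.sqrt_sq (by positivity), hZ]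
  field_simp
  ring
end
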